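/- Let A, B, C, D, E, F be polynomials in the time-delay and time-advance operators. Then the operator Δ₃′ = [E, F]∘([C, D]∘[A, B]) vanishes to first order in the rates: for every smooth φ : ℝ → ℝ and every t ∈ ℝ, the function G(s) = ((Δ₃′)φ)(t), defined for all s in some neighborhood of 0, satisfies G(0) = 0 and G′(0) = 0. -/

import Mathlib

namespace TDI

variable {ι : Type*}

/-- A signed letter: an index together with a sign
(`true` = time-delay operator, `false` = time-advance operator). -/
abbrev Letter (ι : Type*) := ι × Bool

/-- A word: a monomial in the time-delay and time-advance operators. -/
abbrev Word (ι : Type*) := List (Letter ι)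

/-- A polynomial: a finite real linear combination of monomials. -/
abbrev Poly (ι : Type*) := List (ℝ × Word ι)

/-- The time displacement performed by a single letter at expansion parameter `s`:
a time-delay acts by `t ↦ (1 - s·ℓ i)·t - L i`, a time-advance by its inverse map
`t ↦ (t + L i)/(1 - s·ℓ i)`. -/
noncomputable def letterMap (L l : ι → ℝ) (s : ℝ) (x : Letter ι) (t : ℝ) : ℝ :=
  if x.2 then (1 - s * l x.1) * t - L x.1 else (t + L x.1) / (1 - s * l x.1)

/-- The total time displacement performed by a word `w = x₁ ⋯ xₙ`, so that the operator
`D_{x₁} ∘ ⋯ ∘ D_{xₙ}` is precomposition with this map. -/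
noncomputable def wordMap (L l : ι → ℝ) (s : ℝ) : Word ι → ℝ → ℝ
  | [] => id
  | x :: w => wordMap L l s w ∘ letterMap L l s x

/-- The operator on functions associated to a word (monomial): precomposition with
`wordMap`. -/
noncomputable def wordOp (L l : ι → ℝ) (s : ℝ) (w : Word ι) (φ : ℝ → ℝ) : ℝ → ℝ :=
  φ ∘ wordMap L l s w

/-- The operator on functions associated to a polynomial: the corresponding real linear
combination of the monomial operators. -/
noncomputable def polyOp (L l : ι → ℝ) (s : ℝ) (P : Poly ι) (φ : ℝ → ℝ) : ℝ → ℝ :=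
  fun t => (P.map fun cw => cw.1 * wordOp L l s cw.2 φ t).sum

/-- The commutator `[P, Q] = P∘Q − Q∘P` of two operators on functions. -/
def comm (P Q : (ℝ → ℝ) → ℝ → ℝ) (φ : ℝ → ℝ) (t : ℝ) : ℝ :=
  P (Q φ) t - Q (P φ) t

end TDI

namespace TDI

variable {ι : Type*}

lemma letterMap_diff (L l : ι → ℝ) (x : Letter ι) (t : ℝ) :
    DifferentiableAt ℝ (fun p : ℝ × ℝ => letterMap L l p.1 x p.2) (0, t) := by
  unfold letterMap
  split_ifs
  · fun_prop
  · have h1 : DifferentiableAt ℝ (fun p : ℝ × ℝ => p.2 + L x.1) (0, t) := by fun_prop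
    have h2 : DifferentiableAt ℝ (fun p : ℝ × ℝ => 1 - p.1 * l x.1) (0, t) := by fun_prop
    have h3 : DifferentiableAt ℝ (fun p : ℝ × ℝ => (1 - p.1 * l x.1)⁻¹) (0, t) :=
      DifferentiableAt.comp (g := fun y : ℝ => y⁻¹) ((0 : ℝ), t)
        (differentiableAt_inv (by simp)) h2
    simp only [div_eq_mul_inv]
    exact h1.mul h3

lemma wordMap_diff (L l : ι → ℝ) (w : Word ι) : ∀ t : ℝ,
    DifferentiableAt ℝ (fun p : ℝ × ℝ => wordMap L l p.1 w p.2) (0, t) := by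
  induction w with
  | nil => intro t; simp only [wordMap, id]; fun_prop
  | cons x w ih =>
    intro t
    have h1 : DifferentiableAt ℝ (fun p : ℝ × ℝ => (p.1, letterMap L l p.1 x p.2)) (0, t) :=
      DifferentiableAt.prodMk (by fun_prop) (letterMap_diff L l x t)
    exact DifferentiableAt.comp (g := fun p : ℝ × ℝ => wordMap L l p.1 w p.2) (0, t)
      (ih (letterMap L l 0 x t)) h1

lemma wordMap_zero (L l : ι → ℝ) (w : Word ι) : ∃ c : ℝ, ∀ t, wordMap L l 0 w t = t + c := by
  induction w with
  | nil => exact ⟨0, fun t => by simp [wordMap]⟩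
  | cons x w ih =>
    obtain ⟨c, hc⟩ := ih
    rcases x with ⟨i, b⟩
    cases b
    · exact ⟨L i + c, fun t => by simp [wordMap, hc, letterMap, add_assoc]⟩
    · exact ⟨-L i + c, fun t => by simp [wordMap, hc, letterMap]; ring⟩

lemma polyOp_nil (L l : ι → ℝ) (s : ℝ) (f : ℝ → ℝ) (t : ℝ) : polyOp L l s [] f t = 0 := by
  simp [polyOp]

lemma polyOp_cons (L l : ι → ℝ) (s : ℝ) (c : ℝ) (w : Word ι) (P : Poly ι) (f : ℝ → ℝ) (t : ℝ) :
    polyOp L l s ((c, w) :: P) f t = c * f (wordMap L l s w t) + polyOp L l s P f t := by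
  simp [polyOp, wordOp]

lemma polyOp_shift (L l : ι → ℝ) (Q : Poly ι) (f : ℝ → ℝ) (t c : ℝ) :
    polyOp L l 0 Q f (t + c) = polyOp L l 0 Q (fun u => f (u + c)) t := by
  induction Q with
  | nil => simp [polyOp_nil]
  | cons x Q ih =>
    rcases x with ⟨a, w⟩
    obtain ⟨d, hd⟩ := wordMap_zero L l w
    rw [polyOp_cons, polyOp_cons, ih, hd, hd, add_right_comm]

lemma polyOp_add (L l : ι → ℝ) (s : ℝ) (Q : Poly ι) (a : ℝ) (f g : ℝ → ℝ) (t : ℝ) :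
    polyOp L l s Q (fun u => a * f u + g u) t = a * polyOp L l s Q f t + polyOp L l s Q g t := by
  induction Q with
  | nil => simp [polyOp_nil]
  | cons x Q ih =>
    rcases x with ⟨b, w⟩
    rw [polyOp_cons, polyOp_cons, polyOp_cons, ih]; ring

lemma polyOp_zero_fun (L l : ι → ℝ) (s : ℝ) (Q : Poly ι) (t : ℝ) :
    polyOp L l s Q (fun _ => 0) t = 0 := by
  simp [polyOp, wordOp]

lemma polyOp_comm (L l : ι → ℝ) (P Q : Poly ι) (f : ℝ → ℝ) (t : ℝ) :
    polyOp L l 0 P (polyOp L l 0 Q f) t = polyOp L l 0 Q (polyOp L l 0 P f) t := by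
  induction P with
  | nil =>
    have : polyOp L l 0 [] f = fun _ => 0 := funext fun u => polyOp_nil L l 0 f u
    rw [polyOp_nil, this, polyOp_zero_fun]
  | cons x P ih =>
    rcases x with ⟨a, w⟩
    obtain ⟨d, hd⟩ := wordMap_zero L l w
    have : polyOp L l 0 ((a, w) :: P) f = fun u => a * (fun u => f (u + d)) u + polyOp L l 0 P f u := by
      funext u; rw [polyOp_cons, hd]
    rw [polyOp_cons, this, polyOp_add, ih, hd, polyOp_shift]

lemma comm_zero (L l : ι → ℝ) (P Q : Poly ι) (f : ℝ → ℝ) (t : ℝ) :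
    comm (polyOp L l 0 P) (polyOp L l 0 Q) f t = 0 := by
  rw [comm, polyOp_comm, sub_self]

/-- joint differentiability along the line of vanishing parameter -/
def Good (ψ : ℝ → ℝ → ℝ) : Prop :=
  ∀ t, DifferentiableAt ℝ (fun p : ℝ × ℝ => ψ p.1 p.2) (0, t)

lemma Good.polyOp (L l : ι → ℝ) (P : Poly ι) {ψ : ℝ → ℝ → ℝ} (h : Good ψ) :
    Good (fun s => polyOp L l s P (ψ s)) := by
  intro t
  induction P with
  | nil => simp only [polyOp_nil]; fun_prop
  | cons x P ih =>
    rcases x with ⟨a, w⟩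
    simp only [polyOp_cons]
    refine DifferentiableAt.add (DifferentiableAt.const_mul ?_ a) ih
    have h1 : DifferentiableAt ℝ (fun p : ℝ × ℝ => (p.1, wordMap L l p.1 w p.2)) (0, t) :=
      DifferentiableAt.prodMk (by fun_prop) (wordMap_diff L l w t)
    exact DifferentiableAt.comp (g := fun p : ℝ × ℝ => ψ p.1 p.2) (0, t)
      (h (wordMap L l 0 w t)) h1

lemma Good.comm (L l : ι → ℝ) (P Q : Poly ι) {ψ : ℝ → ℝ → ℝ} (h : Good ψ) :
    Good (fun s => comm (TDI.polyOp L l s P) (TDI.polyOp L l s Q) (ψ s)) := fun t =>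
  DifferentiableAt.sub ((h.polyOp L l Q).polyOp L l P t) ((h.polyOp L l P).polyOp L l Q t)

/-- the family vanishes at parameter zero to first order, with parameter derivative `d` -/
def Flat (ψ : ℝ → ℝ → ℝ) (d : ℝ → ℝ) : Prop :=
  ∀ t, HasFDerivAt (fun p : ℝ × ℝ => ψ p.1 p.2) (d t • ContinuousLinearMap.fst ℝ ℝ ℝ) (0, t)

lemma Flat.polyOp (L l : ι → ℝ) (P : Poly ι) {ψ : ℝ → ℝ → ℝ} {d : ℝ → ℝ} (h : Flat ψ d) :
    Flat (fun s => polyOp L l s P (ψ s)) (polyOp L l 0 P d) := by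
  intro t
  induction P with
  | nil => simp only [polyOp_nil, zero_smul]; exact hasFDerivAt_const _ _
  | cons x P ih =>
    rcases x with ⟨a, w⟩
    simp only [polyOp_cons, add_smul, mul_smul]
    refine HasFDerivAt.add (HasFDerivAt.const_mul ?_ a) ih
    have h1 : HasFDerivAt (fun p : ℝ × ℝ => (p.1, wordMap L l p.1 w p.2)) _ (0, t) :=
      HasFDerivAt.prodMk hasFDerivAt_fst (wordMap_diff L l w t).hasFDerivAt
    have h2 := HasFDerivAt.comp (g := fun p : ℝ × ℝ => ψ p.1 p.2) (0, t)
      (h (wordMap L l 0 w t)) h1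
    refine h2.congr_fderiv ?_
    ext <;> simp

lemma Good.flat {ψ : ℝ → ℝ → ℝ} (h : Good ψ) (h0 : ∀ t, ψ 0 t = 0) : ∃ d, Flat ψ d := by
  refine ⟨fun t => fderiv ℝ (fun p : ℝ × ℝ => ψ p.1 p.2) (0, t) (1, 0), fun t => ?_⟩
  refine (h t).hasFDerivAt.congr_fderiv ?_
  have h1 : HasDerivAt (fun u : ℝ => ((0 : ℝ), u)) ((0 : ℝ), (1 : ℝ)) t :=
    (hasDerivAt_const _ _).prodMk (hasDerivAt_id _)
  have h2 := HasFDerivAt.comp_hasDerivAt (l := fun p : ℝ × ℝ => ψ p.1 p.2) t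
    (h t).hasFDerivAt h1
  have h3 : ((fun p : ℝ × ℝ => ψ p.1 p.2) ∘ fun u : ℝ => ((0 : ℝ), u)) = fun _ => 0 :=
    funext fun u => h0 u
  rw [h3] at h2
  have h4 := h2.unique (hasDerivAt_const _ _)
  ext
  · simp
  · simpa using h4

end TDI

/-- **Corollary 1 (second form).** For polynomials `A, B, C, D, E, F` in the time-delay
and time-advance operators, the operator `Δ₃′ = [E, F]∘([C, D]∘[A, B])` vanishes to first
order in the rates: for every smooth `φ` and every `t`, the function `G(s) = ((Δ₃′)φ)(t)`
satisfies `G(0) = 0` and `G′(0) = 0`. -/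
theorem corollary1_product (ι : Type*) [Fintype ι] (L l : ι → ℝ)
    (A B C D E F : TDI.Poly ι) (φ : ℝ → ℝ) (hφ : ContDiff ℝ (⊤ : ℕ∞) φ) (t : ℝ) :
    TDI.comm (TDI.polyOp L l 0 E) (TDI.polyOp L l 0 F)
        (TDI.comm (TDI.polyOp L l 0 C) (TDI.polyOp L l 0 D)
          (TDI.comm (TDI.polyOp L l 0 A) (TDI.polyOp L l 0 B) φ)) t = 0 ∧
      HasDerivAt
        (fun s : ℝ =>
          TDI.comm (TDI.polyOp L l s E) (TDI.polyOp L l s F)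
            (TDI.comm (TDI.polyOp L l s C) (TDI.polyOp L l s D)
              (TDI.comm (TDI.polyOp L l s A) (TDI.polyOp L l s B) φ)) t)
        0 0 := by
  have hg : TDI.Good (fun _ : ℝ => φ) := fun u =>
    DifferentiableAt.comp (g := φ) (f := Prod.snd) ((0 : ℝ), u)
      ((hφ.differentiable (by simp)) _) differentiableAt_snd
  refine ⟨TDI.comm_zero _ _ _ _ _ _, ?_⟩
  obtain ⟨d, hd⟩ := ((hg.comm L l A B).comm L l C D).flat
    (fun u => TDI.comm_zero _ _ _ _ _ _)
  have h1 := ((hd.polyOp L l F).polyOp L l E t).sub ((hd.polyOp L l E).polyOp L l F t)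
  have h2 : HasDerivAt (fun s : ℝ => (s, t)) ((1 : ℝ), (0 : ℝ)) 0 :=
    (hasDerivAt_id _).prodMk (hasDerivAt_const _ _)
  have h3 := HasFDerivAt.comp_hasDerivAt (0 : ℝ) h1 h2
  rw [TDI.polyOp_comm L l E F, sub_self] at h3
  exact h3
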